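/- Let α be a 2-form on ℝ⁷ with ⋆(α∧ω) = α. Then ‖α∧α‖² = 6‖α‖⁴, where for a 2-form ‖α‖² = α_{ij}α_{ij} (summing over i,j with α_{ij} = α(e_i,e_j)) and for a 4-form γ the norm is ‖γ‖² = γ_{ijkl}γ_{ijkl} (summing over i,j,k,l with γ_{ijkl} = γ(e_i,e_j,e_k,e_l)). -/

import Mathlib

open scoped BigOperators

/-- The generalized Kronecker/Levi-Civita epsilon symbol on `Fin 7`. -/
noncomputable def eps (v : Fin 7 → Fin 7) : ℝ :=
  if h : Function.Bijective v then ((Equiv.Perm.sign (Equiv.ofBijective v h) : ℤ) : ℝ) else 0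

/-- The basis monomial form `e_{I 0} ∧ ⋯ ∧ e_{I (p-1)}`, given by its components. -/
noncomputable def mono {p : ℕ} (I : Fin p → Fin 7) : (Fin p → Fin 7) → ℝ :=
  fun v => Matrix.det (Matrix.of fun a b => if I a = v b then (1 : ℝ) else 0)

/-- A (componentwise) `p`-form: totally antisymmetric in its indices. -/
def IsForm {p : ℕ} (c : (Fin p → Fin 7) → ℝ) : Prop :=
  (∀ v : Fin p → Fin 7, ¬ Function.Injective v → c v = 0) ∧
  (∀ (v : Fin p → Fin 7) (σ : Equiv.Perm (Fin p)),
    c (v ∘ σ) = ((Equiv.Perm.sign σ : ℤ) : ℝ) * c v)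

/-- Wedge product of forms, in components. -/
noncomputable def wedge {p q : ℕ} (a : (Fin p → Fin 7) → ℝ) (b : (Fin q → Fin 7) → ℝ) :
    (Fin (p + q) → Fin 7) → ℝ := fun v =>
  (1 / ((Nat.factorial p : ℝ) * (Nat.factorial q : ℝ))) *
    ∑ σ : Equiv.Perm (Fin (p + q)),
      ((Equiv.Perm.sign σ : ℤ) : ℝ) *
        a (fun i => v (σ (Fin.castAdd q i))) * b (fun j => v (σ (Fin.natAdd p j)))

/-- The Hodge star operator (standard metric and orientation on ℝ⁷), in components. -/
noncomputable def hstar {p q : ℕ} (h : p + q = 7) (a : (Fin p → Fin 7) → ℝ) :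
    (Fin q → Fin 7) → ℝ := fun w =>
  (1 / (Nat.factorial p : ℝ)) *
    ∑ v : Fin p → Fin 7, a v * eps (fun i => Fin.append v w (Fin.cast h.symm i))

/-- The fundamental 3-form ω = e₁₂₄+e₂₃₅+e₃₄₆+e₄₅₇+e₅₆₁+e₆₇₂+e₇₁₃ (indices shifted to 0,…,6). -/
noncomputable def ω : (Fin 3 → Fin 7) → ℝ :=
  mono ![0, 1, 3] + mono ![1, 2, 4] + mono ![2, 3, 5] + mono ![3, 4, 6] +
    mono ![4, 5, 0] + mono ![5, 6, 1] + mono ![6, 0, 2]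

/-- The 4-form Φ = −e₃₅₆₇−e₄₆₇₁−e₅₇₁₂−e₆₁₂₃−e₇₂₃₄−e₁₃₄₅−e₂₄₅₆ (indices shifted to 0,…,6). -/
noncomputable def Φ : (Fin 4 → Fin 7) → ℝ :=
  -mono ![2, 4, 5, 6] - mono ![3, 5, 6, 0] - mono ![4, 6, 0, 1] - mono ![5, 0, 1, 2] -
    mono ![6, 1, 2, 3] - mono ![0, 2, 3, 4] - mono ![1, 3, 4, 5]

/-- Components ω_{ijk}. -/
noncomputable def ω3 (i j k : Fin 7) : ℝ := ω ![i, j, k]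

/-- Components ω_{ijkl} = Φ(e_i,e_j,e_k,e_l). -/
noncomputable def ω4 (i j k l : Fin 7) : ℝ := Φ ![i, j, k, l]

/-- Kronecker delta. -/
def δ (i j : Fin 7) : ℝ := if i = j then 1 else 0

/-- Components of a 2-form. -/
def c2 (a : (Fin 2 → Fin 7) → ℝ) (i j : Fin 7) : ℝ := a ![i, j]

/-- The operator α ↦ ⋆(α ∧ ω) on 2-forms. -/
noncomputable def Lω (a : (Fin 2 → Fin 7) → ℝ) : (Fin 2 → Fin 7) → ℝ :=
  hstar (p := 5) (q := 2) rfl (wedge a ω)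

open Equiv in
theorem eps_comp_perm (v : Fin 7 → Fin 7) (τ : Perm (Fin 7)) :
    eps (v ∘ τ) = ((Perm.sign τ : ℤ) : ℝ) * eps v := by
  by_cases h : Function.Bijective v
  · have h' : Function.Bijective (v ∘ τ) := h.comp τ.bijective
    have e : Equiv.ofBijective (v ∘ τ) h' = Equiv.ofBijective v h * τ := by
      ext i; simp
    rw [eps, eps, dif_pos h, dif_pos h', e, Perm.sign_mul]
    push_cast
    ring
  · have h' : ¬ Function.Bijective (v ∘ τ) := fun hb => h (by
      simpa [Function.comp_assoc] using hb.comp τ.symm.bijective)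
    rw [eps, eps, dif_neg h, dif_neg h', mul_zero]

/-- `eps` as the product of the signs of the differences `v j - v i` over `i < j`. -/
def epsInt (v : Fin 7 → Fin 7) : ℤ :=
  ∏ j, ∏ i ∈ Finset.Iio j, if v i < v j then 1 else if v i = v j then 0 else -1

theorem eps_eq_epsInt (v : Fin 7 → Fin 7) : eps v = epsInt v := by
  by_cases h : Function.Bijective v
  · rw [eps, dif_pos h, Equiv.Perm.sign_eq_prod_prod_Iio, epsInt]
    push_cast
    refine Finset.prod_congr rfl fun j _ => Finset.prod_congr rfl fun i hi => ?_
    have hne : v i ≠ v j := fun e => (Finset.mem_Iio.mp hi).ne (h.1 e)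
    by_cases hlt : v i < v j <;> simp [hlt, hne]
  · rw [eps, dif_neg h, epsInt]
    obtain ⟨i, j, hlt, hij⟩ : ∃ i j, i < j ∧ v i = v j := by
      have hinj : ¬ Function.Injective v := fun hi => h (Finite.injective_iff_bijective.mp hi)
      simp only [Function.Injective, not_forall] at hinj
      obtain ⟨i, j, e, hne⟩ := hinj
      rcases lt_or_gt_of_ne hne with hl | hl
      exacts [⟨i, j, hl, e⟩, ⟨j, i, hl, e.symm⟩]
    rw [Finset.prod_eq_zero (Finset.mem_univ j)
      (Finset.prod_eq_zero (Finset.mem_Iio.mpr hlt) (by simp [hij]))]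
    simp

open Equiv in
theorem eps_append_perm_left {p q : ℕ} (h : p + q = 7) (v : Fin p → Fin 7) (w : Fin q → Fin 7)
    (σ : Perm (Fin p)) :
    eps (fun i => Fin.append (v ∘ σ) w (Fin.cast h.symm i)) =
      ((Perm.sign σ : ℤ) : ℝ) * eps (fun i => Fin.append v w (Fin.cast h.symm i)) := by
  let e : Fin p ⊕ Fin q ≃ Fin 7 := finSumFinEquiv.trans (finCongr h)
  have key : (fun i => Fin.append (v ∘ σ) w (Fin.cast h.symm i)) =
      (fun i => Fin.append v w (Fin.cast h.symm i)) ∘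
        e.permCongr (Perm.sumCongr σ (1 : Perm (Fin q))) := by
    funext i
    obtain ⟨x, rfl⟩ := e.surjective i
    cases x <;> simp [e]
  rw [key, eps_comp_perm, Perm.sign_permCongr, Perm.sign_sumCongr, Perm.sign_one, mul_one]

open Equiv in
theorem Fin.append_comp_perm_right {p q : ℕ} (u : Fin p → Fin 7) (v : Fin q → Fin 7)
    (σ : Perm (Fin q)) :
    Fin.append u (v ∘ σ) =
      Fin.append u v ∘ finSumFinEquiv.permCongr (Perm.sumCongr (1 : Perm (Fin p)) σ) := by
  funext i
  obtain ⟨x, rfl⟩ := finSumFinEquiv.surjective i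
  cases x <;> simp

open Equiv in
theorem hstar_wedge {p q r : ℕ} (h : p + q + r = 7) (a : (Fin p → Fin 7) → ℝ)
    (b : (Fin q → Fin 7) → ℝ) (w : Fin r → Fin 7) :
    hstar h (wedge a b) w = 1 / ((p.factorial : ℝ) * q.factorial) *
      ∑ u, ∑ v, a u * b v *
        eps (fun i => Fin.append (Fin.append u v) w (Fin.cast h.symm i)) := by
  have perm (σ : Perm (Fin (p + q))) :
      ∑ v : Fin (p + q) → Fin 7, ((Perm.sign σ : ℤ) : ℝ) *
        a (fun i => v (σ (Fin.castAdd q i))) * b (fun j => v (σ (Fin.natAdd p j))) *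
          eps (fun i => Fin.append v w (Fin.cast h.symm i)) =
      ∑ u, ∑ v, a u * b v *
        eps (fun i => Fin.append (Fin.append u v) w (Fin.cast h.symm i)) := by
    rw [← Fintype.sum_prod_type']
    refine Fintype.sum_equiv ((σ.symm.arrowCongr (Equiv.refl (Fin 7))).trans
      (Fin.appendEquiv p q).symm) _ _ fun v => ?_
    have hv : Fin.append (fun i => v (σ (Fin.castAdd q i))) (fun j => v (σ (Fin.natAdd p j))) =
        v ∘ σ := by
      funext i
      refine Fin.addCases (fun i => ?_) (fun i => ?_) i <;> simp
    have := eps_append_perm_left h v w σ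
    rw [← hv] at this
    simp only [Equiv.trans_apply, Fin.appendEquiv, Equiv.coe_fn_symm_mk, Equiv.arrowCongr_apply,
      Equiv.coe_refl, Function.comp_apply, id, Equiv.symm_symm]
    rw [this]
    ring
  simp only [hstar, wedge, mul_assoc, Finset.sum_mul, ← Finset.mul_sum]
  rw [Finset.sum_comm]
  simp only [← mul_assoc]
  simp only [perm, Finset.sum_const, Finset.card_univ, Fintype.card_perm, Fintype.card_fin,
    nsmul_eq_mul]
  have : ((p + q).factorial : ℝ) ≠ 0 := by positivity
  field_simp
  simp only [Finset.mul_sum, mul_assoc]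

open Equiv in
theorem sum_mono_mul {p : ℕ} (I : Fin p → Fin 7) (F : (Fin p → Fin 7) → ℝ)
    (hF : ∀ v (σ : Perm (Fin p)), F (v ∘ σ) = ((Perm.sign σ : ℤ) : ℝ) * F v) :
    ∑ v, mono I v * F v = p.factorial * F I := by
  have hmono (v : Fin p → Fin 7) : mono I v =
      ∑ σ : Perm (Fin p), ((Perm.sign σ : ℤ) : ℝ) * if v = I ∘ σ then 1 else 0 := by
    rw [mono, Matrix.det_apply']
    refine Finset.sum_congr rfl fun σ _ => ?_
    simp [Finset.prod_ite_zero, funext_iff, eq_comm]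
  simp only [hmono, Finset.sum_mul]
  rw [Finset.sum_comm]
  have hsq (σ : Perm (Fin p)) : ((Perm.sign σ : ℤ) : ℝ) * ((Perm.sign σ : ℤ) : ℝ) = 1 := by
    rcases Int.units_eq_one_or (Perm.sign σ) with h | h <;> simp [h]
  simp [hF, ← mul_assoc, hsq, Fintype.card_perm]

/-- The coefficient of `c2 α i j` in `2 * Lω α ![k, l]`. -/
def lomegaCoeff (i j k l : Fin 7) : ℤ :=
  epsInt ![i, j, 0, 1, 3, k, l] + epsInt ![i, j, 1, 2, 4, k, l] +
    epsInt ![i, j, 2, 3, 5, k, l] + epsInt ![i, j, 3, 4, 6, k, l] +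
    epsInt ![i, j, 4, 5, 0, k, l] + epsInt ![i, j, 5, 6, 1, k, l] +
    epsInt ![i, j, 6, 0, 2, k, l]

theorem Lω_apply (α : (Fin 2 → Fin 7) → ℝ) (k l : Fin 7) :
    Lω α ![k, l] = 1 / 2 * ∑ i, ∑ j, c2 α i j * lomegaCoeff i j k l := by
  have hanti (u : Fin 2 → Fin 7) (v : Fin 3 → Fin 7) (σ : Equiv.Perm (Fin 3)) :
      eps (fun i => Fin.append (Fin.append u (v ∘ σ)) ![k, l] (Fin.cast rfl i)) =
        ((Equiv.Perm.sign σ : ℤ) : ℝ) *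
          eps (fun i => Fin.append (Fin.append u v) ![k, l] (Fin.cast rfl i)) := by
    rw [Fin.append_comp_perm_right, eps_append_perm_left rfl, Equiv.Perm.sign_permCongr,
      Equiv.Perm.sign_sumCongr, Equiv.Perm.sign_one, one_mul]
  have hv (i j : Fin 7) (I : Fin 3 → Fin 7) :
      (fun x : Fin 7 => Fin.append (Fin.append ![i, j] I) ![k, l] (Fin.cast rfl x)) =
        ![i, j, I 0, I 1, I 2, k, l] := by
    funext x
    fin_cases x <;> rfl
  rw [show Lω α ![k, l] = _ from hstar_wedge (p := 2) (q := 3) (r := 2) rfl α ω ![k, l]]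
  have hmono (u : Fin 2 → Fin 7) (I : Fin 3 → Fin 7) := sum_mono_mul I
    (fun v => eps fun i => Fin.append (Fin.append u v) ![k, l] (Fin.cast rfl i)) (hanti u)
  simp only [mul_assoc, ← Finset.mul_sum]
  simp only [ω, Pi.add_apply, add_mul, Finset.sum_add_distrib, hmono]
  rw [← (finTwoArrowEquiv (Fin 7)).symm.sum_comp, Fintype.sum_prod_type]
  simp only [finTwoArrowEquiv_symm_apply, hv, eps_eq_epsInt, c2, lomegaCoeff, Finset.mul_sum]
  refine Finset.sum_congr rfl fun i _ => Finset.sum_congr rfl fun j _ => ?_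
  simp [Nat.factorial]
  ring

theorem lomegaCoeff_add_one (s i j : Fin 7) :
    lomegaCoeff i j s (s + 1) =
      (if i = s + 2 then if j = s + 5 then 1 else 0 else 0) -
      (if i = s + 5 then if j = s + 2 then 1 else 0 else 0) +
      (if i = s + 6 then if j = s + 4 then 1 else 0 else 0) -
      (if i = s + 4 then if j = s + 6 then 1 else 0 else 0) := by
  revert s i j
  decide +kernel

theorem IsForm.c2_swap {α : (Fin 2 → Fin 7) → ℝ} (hα : IsForm α) (i j : Fin 7) :
    c2 α i j = -c2 α j i := by
  have h := hα.2 ![j, i] (Equiv.swap 0 1)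
  have e : ![j, i] ∘ Equiv.swap (0 : Fin 2) 1 = ![i, j] := by
    funext x
    fin_cases x <;> simp
  rw [e] at h
  simpa [c2] using h

theorem c2_add_one_of_Lω_eq {α : (Fin 2 → Fin 7) → ℝ} (hα : IsForm α) (h14 : Lω α = α)
    (s : Fin 7) :
    c2 α s (s + 1) = c2 α (s + 2) (s + 5) + c2 α (s + 6) (s + 4) := by
  have h := congrFun h14 ![s, s + 1]
  rw [Lω_apply] at h
  simp only [lomegaCoeff_add_one] at h
  push_cast at h
  simp only [mul_add, mul_sub, Finset.sum_add_distrib, Finset.sum_sub_distrib, mul_ite, mul_one,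
    mul_zero, Finset.sum_ite_eq', Finset.mem_univ, if_true, Finset.sum_const_zero,
    Finset.sum_ite_irrel] at h
  rw [hα.c2_swap (s + 5) (s + 2), hα.c2_swap (s + 4) (s + 6)] at h
  change _ = c2 α s (s + 1) at h
  linarith

theorem wedge_self_apply {α : (Fin 2 → Fin 7) → ℝ} (hα : IsForm α) (i j k l : Fin 7) :
    wedge α α ![i, j, k, l] =
      2 * (c2 α i j * c2 α k l - c2 α i k * c2 α j l + c2 α i l * c2 α j k) := by
  have hc (f : Fin 2 → Fin 7) : α f = c2 α (f 0) (f 1) := by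
    rw [c2]
    congr 1
    funext x
    fin_cases x <;> rfl
  simp only [wedge, hc]
  have hperm {n : ℕ} (f : Equiv.Perm (Fin (n + 1)) → ℝ) : ∑ σ, f σ =
      ∑ p, ∑ τ, f (Equiv.Perm.decomposeFin.symm (p, τ)) := by
    rw [← Equiv.Perm.decomposeFin.symm.sum_comp, Fintype.sum_prod_type]
  rw [hperm (n := 3)]
  simp only [hperm (n := 2), hperm (n := 1), Finset.univ_unique,
    Finset.sum_singleton, Fin.sum_univ_four, Fin.sum_univ_three, Fin.sum_univ_two]
  have h42 (p : Fin 4) (τ : Equiv.Perm (Fin 3)) :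
      Equiv.Perm.decomposeFin.symm (p, τ) 2 = Equiv.swap 0 p (τ 1).succ :=
    Equiv.Perm.decomposeFin_symm_apply_succ τ p 1
  have h43 (p : Fin 4) (τ : Equiv.Perm (Fin 3)) :
      Equiv.Perm.decomposeFin.symm (p, τ) 3 = Equiv.swap 0 p (τ 2).succ :=
    Equiv.Perm.decomposeFin_symm_apply_succ τ p 2
  have h32 (p : Fin 3) (τ : Equiv.Perm (Fin 2)) :
      Equiv.Perm.decomposeFin.symm (p, τ) 2 = Equiv.swap 0 p (τ 1).succ :=
    Equiv.Perm.decomposeFin_symm_apply_succ τ p 1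
  simp +decide [h42, h43, h32, Equiv.swap_apply_def]
  rw [hα.c2_swap j i, hα.c2_swap k i, hα.c2_swap l i, hα.c2_swap k j, hα.c2_swap l j,
    hα.c2_swap l k]
  ring

/-- The sum of squares of the components of `α ∧ α / 2`, through the trace of the fourth power. -/
theorem sum_pfaffian_sq {n : ℕ} (A : Fin n → Fin n → ℝ) (hA : ∀ i j, A i j = -A j i) :
    ∑ i, ∑ j, ∑ k, ∑ l, (A i j * A k l - A i k * A j l + A i l * A j k) ^ 2 =
      3 * (∑ i, ∑ j, A i j * A i j) ^ 2 - 6 * ∑ i, ∑ k, (∑ j, A i j * A j k) ^ 2 := by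
  have hN : (∑ i, ∑ j, A i j * A i j) ^ 2 =
      ∑ i, ∑ j, ∑ k, ∑ l, (A i j * A i j) * (A k l * A k l) := by
    simp only [sq, Finset.sum_mul]
    simp only [Finset.mul_sum]
  have hT : ∑ i, ∑ k, (∑ j, A i j * A j k) ^ 2 =
      ∑ i, ∑ k, ∑ j, ∑ l, (A i j * A j k) * (A i l * A l k) := by
    simp only [sq, Finset.sum_mul, Finset.mul_sum]
    refine Finset.sum_congr rfl fun i _ => Finset.sum_congr rfl fun k _ => ?_
    rw [Finset.sum_comm]
  have hN₂ : (∑ i, ∑ j, A i j * A i j) ^ 2 =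
      ∑ i, ∑ j, ∑ k, ∑ l, (A i k * A i k) * (A j l * A j l) := by
    rw [hN]
    exact Finset.sum_congr rfl fun i _ => Finset.sum_comm
  have hN₃ : (∑ i, ∑ j, A i j * A i j) ^ 2 =
      ∑ i, ∑ j, ∑ k, ∑ l, (A i l * A i l) * (A j k * A j k) := by
    rw [hN₂]
    exact Finset.sum_congr rfl fun i _ => Finset.sum_congr rfl fun j _ => Finset.sum_comm
  have hT₂ : ∑ i, ∑ k, (∑ j, A i j * A j k) ^ 2 =
      ∑ i, ∑ j, ∑ k, ∑ l, (A i j * A j k) * (A i l * A l k) := by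
    rw [hT]
    exact Finset.sum_congr rfl fun i _ => Finset.sum_comm
  have hT₃ : ∑ i, ∑ k, (∑ j, A i j * A j k) ^ 2 =
      ∑ i, ∑ j, ∑ k, ∑ l, (A i j * A j l) * (A i k * A k l) := by
    rw [hT₂]
    exact Finset.sum_congr rfl fun i _ => Finset.sum_congr rfl fun j _ => Finset.sum_comm
  have expand (i j k l : Fin n) : (A i j * A k l - A i k * A j l + A i l * A j k) ^ 2 =
      (A i j * A i j) * (A k l * A k l) + (A i k * A i k) * (A j l * A j l) +
        (A i l * A i l) * (A j k * A j k) -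
        ((A i j * A j l) * (A i k * A k l) + (A i k * A k j) * (A i l * A l j) +
          (A i j * A j k) * (A i l * A l k)) -
        ((A i j * A j l) * (A i k * A k l) + (A i k * A k j) * (A i l * A l j) +
          (A i j * A j k) * (A i l * A l k)) := by
    rw [hA k j, hA l j, hA l k]
    ring
  simp only [expand, Finset.sum_add_distrib, Finset.sum_sub_distrib]
  linarith

theorem sum_sq_mul_self_of_cyclic (A : Fin 7 → Fin 7 → ℝ) (hA : ∀ i j, A i j = -A j i)
    (h : ∀ s, A s (s + 1) = A (s + 2) (s + 5) + A (s + 6) (s + 4)) :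
    4 * ∑ i, ∑ k, (∑ j, A i j * A j k) ^ 2 = (∑ i, ∑ j, A i j * A i j) ^ 2 := by
  have hd (i : Fin 7) : A i i = 0 := by linarith [hA i i]
  have h0 : A 0 1 = A 2 5 + A 6 4 := h 0
  have h1 : A 1 2 = A 3 6 + A 0 5 := h 1
  have h2 : A 2 3 = A 4 0 + A 1 6 := h 2
  have h3 : A 3 4 = A 5 1 + A 2 0 := h 3
  have h4 : A 4 5 = A 6 2 + A 3 1 := h 4
  have h5 : A 5 6 = A 0 3 + A 4 2 := h 5
  have h6 : A 6 0 = A 1 4 + A 5 3 := h 6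
  simp only [Fin.sum_univ_seven, hd, hA 1 0, hA 2 0, hA 3 0, hA 4 0, hA 5 0, hA 0 6, hA 2 1,
    hA 3 1, hA 4 1, hA 5 1, hA 6 1, hA 3 2, hA 4 2, hA 5 2, hA 6 2, hA 4 3, hA 5 3, hA 6 3,
    hA 5 4, hA 6 4, hA 6 5, h0, h1, h2, h3, h4, h5, h6]
  ring

theorem lambda14_wedge_square_norm (α : (Fin 2 → Fin 7) → ℝ) (hα : IsForm α) (h14 : Lω α = α) :
    (∑ i : Fin 7, ∑ j : Fin 7, ∑ k : Fin 7, ∑ l : Fin 7,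
        wedge α α ![i, j, k, l] * wedge α α ![i, j, k, l]) =
      6 * (∑ i : Fin 7, ∑ j : Fin 7, c2 α i j * c2 α i j) ^ 2 := by
  simp only [wedge_self_apply hα]
  have h1 := sum_pfaffian_sq (c2 α) hα.c2_swap
  have h2 := sum_sq_mul_self_of_cyclic (c2 α) hα.c2_swap (c2_add_one_of_Lω_eq hα h14)
  have h3 (x : ℝ) : 2 * x * (2 * x) = 4 * x ^ 2 := by ring
  simp only [h3, ← Finset.mul_sum]
  linarith
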